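/- Let G=(V,E) be a finite simple undirected graph with preferences as described, assume P≠∅, let x∈P, and let σ be a strongly stable matching in G. Let v ∈ P' and let e={v,w} be an edge in W_x(v). Then w ∈ Q'. -/

import Mathlib

/-!
Common setup: a finite simple undirected graph `G = (V, E)` where edges are
elements of `Sym2 V`, together with, for each vertex `v`, a complete and
transitive preference relation `pref v` on `E(v) ∪ {∅}` (the unmatched
option `∅` is encoded as `none : Option (Sym2 V)`), where every incident
edge is strictly preferred to `∅`.
-/

/-- A roommates instance: a finite simple graph with preferences. -/
structure RSetup (V : Type*) [Fintype V] [DecidableEq V] where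
  /-- the edge set -/
  E : Finset (Sym2 V)
  /-- the graph is simple: no loops -/
  not_diag : ∀ e ∈ E, ¬ e.IsDiag
  /-- the preference relation `≿ᵥ` of each vertex, on `E(v) ∪ {∅}` -/
  pref : V → Option (Sym2 V) → Option (Sym2 V) → Prop
  /-- completeness of `≿ᵥ` on `E(v) ∪ {∅}` -/
  pref_total : ∀ v : V, ∀ a b : Option (Sym2 V),
    (∀ e, a = some e → e ∈ E ∧ v ∈ e) → (∀ e, b = some e → e ∈ E ∧ v ∈ e) →
    pref v a b ∨ pref v b a
  /-- transitivity of `≿ᵥ` on `E(v) ∪ {∅}` -/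
  pref_trans : ∀ v : V, ∀ a b c : Option (Sym2 V),
    (∀ e, a = some e → e ∈ E ∧ v ∈ e) → (∀ e, b = some e → e ∈ E ∧ v ∈ e) →
    (∀ e, c = some e → e ∈ E ∧ v ∈ e) →
    pref v a b → pref v b c → pref v a c
  /-- every incident edge is strictly preferred to being unmatched -/
  pref_none : ∀ v : V, ∀ e ∈ E, v ∈ e →
    pref v (some e) none ∧ ¬ pref v none (some e)

namespace RSetup

variable {V : Type*} [Fintype V] [DecidableEq V] (S : RSetup V)

/-- `a ≻ᵥ b` : strict preference. -/
def SPref (v : V) (a b : Option (Sym2 V)) : Prop :=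
  S.pref v a b ∧ ¬ S.pref v b a

/-- `a ∼ᵥ b` : indifference. -/
def IPref (v : V) (a b : Option (Sym2 V)) : Prop :=
  S.pref v a b ∧ S.pref v b a

/-- `F(v)` : the set of edges in `F` incident to `v`. -/
def inc (F : Finset (Sym2 V)) (v : V) : Finset (Sym2 V) :=
  F.filter (fun e => v ∈ e)

/-- a matching in `G` -/
def IsMatching (μ : Finset (Sym2 V)) : Prop :=
  μ ⊆ S.E ∧ ∀ v : V, (inc μ v).card ≤ 1

/-- `μ(v)` : the edge of `μ` incident to `v` (or `none`). -/
noncomputable def matchOf (μ : Finset (Sym2 V)) (v : V) : Option (Sym2 V) :=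
  (inc μ v).toList.head?

/-- `e` blocks the matching `μ`. -/
def Blocks (μ : Finset (Sym2 V)) (e : Sym2 V) : Prop :=
  e ∈ S.E ∧ e ∉ μ ∧ (∀ v ∈ e, S.pref v (some e) (matchOf μ v)) ∧
    (∃ v ∈ e, S.SPref v (some e) (matchOf μ v))

/-- a strongly stable matching in `G` -/
def StronglyStable (μ : Finset (Sym2 V)) : Prop :=
  S.IsMatching μ ∧ ∀ e : Sym2 V, ¬ S.Blocks μ e

/-- `x(W) = ∑_{e ∈ W} x(e)` -/
def xS (x : Sym2 V → ℝ) (W : Finset (Sym2 V)) : ℝ := ∑ e ∈ W, x e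

/-- `x ∈ ℝ₊^E`, encoded as a nonnegative function on `Sym2 V` vanishing
outside `E`. -/
def IsVec (x : Sym2 V → ℝ) : Prop :=
  (∀ e, 0 ≤ x e) ∧ ∀ e ∉ S.E, x e = 0

open Classical in
/-- `E[∼ᵥ e] = {f ∈ E(v) : f ∼ᵥ e}` -/
noncomputable def simSet (v : V) (e : Sym2 V) : Finset (Sym2 V) :=
  (inc S.E v).filter (fun f => S.IPref v (some f) (some e))

open Classical in
/-- `E[≻ᵥ e] = {f ∈ E(v) : f ≻ᵥ e}` -/
noncomputable def succSet (v : V) (e : Sym2 V) : Finset (Sym2 V) :=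
  (inc S.E v).filter (fun f => S.SPref v (some f) (some e))

open Classical in
/-- `E⟨X⟩ = {e ∈ E : e ⊆ X}` -/
noncomputable def esub (X : Finset V) : Finset (Sym2 V) :=
  S.E.filter (fun e => ∀ u ∈ e, u ∈ X)

/-- constraint (1): `x(E(v)) ≤ 1` for every vertex `v` -/
def C1 (x : Sym2 V → ℝ) : Prop := ∀ v : V, xS x (inc S.E v) ≤ 1

/-- constraint (2): `x(E[∼ᵥ e]) + ∑_{w ∈ e} x(E[≻_w e]) ≥ 1`
for every edge `e ∈ E` and `v ∈ e` -/
def C2 (x : Sym2 V → ℝ) : Prop := ∀ v w : V, s(v, w) ∈ S.E →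
  xS x (S.simSet v s(v, w)) +
    (xS x (S.succSet v s(v, w)) + xS x (S.succSet w s(v, w))) ≥ 1

/-- constraint (3): `x(E⟨X⟩) ≤ ⌊|X|/2⌋` for every odd `X ⊆ V` -/
def C3 (x : Sym2 V → ℝ) : Prop := ∀ X : Finset V, Odd X.card →
  xS x (S.esub X) ≤ ((X.card / 2 : ℕ) : ℝ)

/-- membership in the polytope `P` -/
def memP (x : Sym2 V → ℝ) : Prop := S.IsVec x ∧ S.C1 x ∧ S.C2 x ∧ S.C3 x

/-- the characteristic vector `χ_μ` of a set of edges -/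
def chi (μ : Finset (Sym2 V)) : Sym2 V → ℝ := fun e => if e ∈ μ then 1 else 0

open Classical in
/-- `E_x = {e ∈ E : x(e) > 0}` -/
noncomputable def supp (x : Sym2 V → ℝ) : Finset (Sym2 V) :=
  S.E.filter (fun e => 0 < x e)

/-- `V₁` : the set of vertices `v` with `x(E(v)) > 0` for some `x ∈ P` -/
def V1 : Set V := {v : V | ∃ x : Sym2 V → ℝ, S.memP x ∧ 0 < xS x (inc S.E v)}

open Classical in
/-- `B_x(v)` : the best edges in `E_x(v)` for `v` -/
noncomputable def Bset (x : Sym2 V → ℝ) (v : V) : Finset (Sym2 V) :=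
  (inc (S.supp x) v).filter
    (fun e => ∀ f ∈ inc (S.supp x) v, S.pref v (some e) (some f))

open Classical in
/-- `W_x(v)` : the worst edges in `E_x(v)` for `v` -/
noncomputable def Wset (x : Sym2 V → ℝ) (v : V) : Finset (Sym2 V) :=
  (inc (S.supp x) v).filter
    (fun e => ∀ f ∈ inc (S.supp x) v, S.pref v (some f) (some e))

/-- a nonempty `F ⊆ E(v)` is flat if `v` is indifferent among its members -/
def Flat (v : V) (F : Finset (Sym2 V)) : Prop :=
  F.Nonempty ∧ ∀ e ∈ F, ∀ f ∈ F, S.IPref v (some e) (some f)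

open Classical in
/-- `T_x` : edges `e ∈ E⟨V₁⟩` such that, for each `v ∈ e`, either
`e ∈ B_x(v) ∪ W_x(v)` or `B_x(v) ≻ᵥ e ≻ᵥ W_x(v)`. -/
noncomputable def Tset (x : Sym2 V → ℝ) : Finset (Sym2 V) :=
  (S.E.filter (fun e => ∀ u ∈ e, u ∈ S.V1)).filter (fun e => ∀ v ∈ e,
    (e ∈ S.Bset x v ∪ S.Wset x v) ∨
      ((∀ f ∈ S.Bset x v, S.SPref v (some f) (some e)) ∧
        (∀ f ∈ S.Wset x v, S.SPref v (some e) (some f))))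

/-- membership in `P(F) = {x ∈ P : x(e) = 0 for all e ∈ E \ F}` -/
def memPF (F : Finset (Sym2 V)) (x : Sym2 V → ℝ) : Prop :=
  S.memP x ∧ ∀ e ∈ S.E, e ∉ F → x e = 0

open Classical in
/-- `E⁺ = {e ∈ E : e ∈ E_z for some z ∈ P}` -/
noncomputable def Eplus : Finset (Sym2 V) :=
  S.E.filter (fun e => ∃ z : Sym2 V → ℝ, S.memP z ∧ 0 < z e)

open Classical in
/-- `P'` : given `x ∈ P` and a strongly stable matching `σ`, the set of
vertices `v ∈ V₁` with `W_x(v) ≻ᵥ σ(v)`, or with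
`B_x(v) ≻ᵥ W_x(v)` and `W_x(v) ∼ᵥ σ(v)`. -/
def Pset (x : Sym2 V → ℝ) (σ : Finset (Sym2 V)) : Set V :=
  {v : V | v ∈ S.V1 ∧
    ((∀ f ∈ S.Wset x v, S.SPref v (some f) (matchOf σ v)) ∨
      ((∀ f ∈ S.Bset x v, ∀ g ∈ S.Wset x v, S.SPref v (some f) (some g)) ∧
        (∀ f ∈ S.Wset x v, S.IPref v (some f) (matchOf σ v))))}

/-- `Q'` : given `x ∈ P` and a strongly stable matching `σ`, the set of
vertices `v ∈ V₁` with `σ(v) ≻ᵥ B_x(v)`, or with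
`B_x(v) ≻ᵥ W_x(v)` and `B_x(v) ∼ᵥ σ(v)`. -/
def Qset (x : Sym2 V → ℝ) (σ : Finset (Sym2 V)) : Set V :=
  {v : V | v ∈ S.V1 ∧
    ((∀ f ∈ S.Bset x v, S.SPref v (matchOf σ v) (some f)) ∨
      ((∀ f ∈ S.Bset x v, ∀ g ∈ S.Wset x v, S.SPref v (some f) (some g)) ∧
        (∀ f ∈ S.Bset x v, S.IPref v (some f) (matchOf σ v))))}

/-- `R'` : given `x ∈ P` and a strongly stable matching `σ`, the set of
vertices `v ∈ V₁` such that `E_x(v)` is flat and `E_x(v) ∼ᵥ σ(v)`. -/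
def Rset (x : Sym2 V → ℝ) (σ : Finset (Sym2 V)) : Set V :=
  {v : V | v ∈ S.V1 ∧ S.Flat v (inc (S.supp x) v) ∧
    ∀ f ∈ inc (S.supp x) v, S.IPref v (some f) (matchOf σ v)}

end RSetup

namespace RSetup

variable {V : Type*} [Fintype V] [DecidableEq V] {S : RSetup V}

omit [Fintype V] in
theorem mem_inc {F : Finset (Sym2 V)} {v : V} {e : Sym2 V} :
    e ∈ inc F v ↔ e ∈ F ∧ v ∈ e := by
  simp [inc]

theorem mem_simSet {v : V} {e f : Sym2 V} :
    f ∈ S.simSet v e ↔ f ∈ inc S.E v ∧ S.IPref v (some f) (some e) := by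
  simp [simSet]

theorem mem_succSet {v : V} {e f : Sym2 V} :
    f ∈ S.succSet v e ↔ f ∈ inc S.E v ∧ S.SPref v (some f) (some e) := by
  simp [succSet]

theorem pref_total_some {v : V} {e f : Sym2 V} (he : e ∈ inc S.E v) (hf : f ∈ inc S.E v) :
    S.pref v (some e) (some f) ∨ S.pref v (some f) (some e) :=
  S.pref_total v _ _ (by rintro _ ⟨⟩; exact mem_inc.1 he) (by rintro _ ⟨⟩; exact mem_inc.1 hf)

theorem pref_refl_some {v : V} {e : Sym2 V} (he : e ∈ inc S.E v) :
    S.pref v (some e) (some e) :=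
  (pref_total_some he he).elim id id

theorem pref_trans_some {v : V} {e f g : Sym2 V} (he : e ∈ inc S.E v) (hf : f ∈ inc S.E v)
    (hg : g ∈ inc S.E v) (hef : S.pref v (some e) (some f)) (hfg : S.pref v (some f) (some g)) :
    S.pref v (some e) (some g) :=
  S.pref_trans v _ _ _ (by rintro _ ⟨⟩; exact mem_inc.1 he) (by rintro _ ⟨⟩; exact mem_inc.1 hf)
    (by rintro _ ⟨⟩; exact mem_inc.1 hg) hef hfg

omit [Fintype V] in
theorem mem_of_matchOf_eq_some {σ : Finset (Sym2 V)} {v : V} {f : Sym2 V}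
    (h : matchOf σ v = some f) : f ∈ inc σ v :=
  Finset.mem_toList.1 (List.mem_of_head? h)

theorem IsMatching.matchOf_eq_some {σ : Finset (Sym2 V)} (hσ : S.IsMatching σ) {v : V}
    {f : Sym2 V} (hf : f ∈ inc σ v) : matchOf σ v = some f := by
  cases h : matchOf σ v with
  | none =>
    rw [matchOf, List.head?_eq_none_iff, Finset.toList_eq_nil] at h
    simp [h] at hf
  | some g =>
    rw [Finset.card_le_one.1 (hσ.2 v) _ hf _ (mem_of_matchOf_eq_some h)]

omit [Fintype V] [DecidableEq V] in
theorem xS_nonneg {x : Sym2 V → ℝ} (hx : ∀ e, 0 ≤ x e) (W : Finset (Sym2 V)) : 0 ≤ xS x W :=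
  Finset.sum_nonneg fun e _ => hx e

omit [Fintype V] [DecidableEq V] in
theorem le_xS {x : Sym2 V → ℝ} (hx : ∀ e, 0 ≤ x e) {W : Finset (Sym2 V)} {e : Sym2 V}
    (he : e ∈ W) : x e ≤ xS x W :=
  Finset.single_le_sum (fun e _ => hx e) he

omit [Fintype V] [DecidableEq V] in
theorem exists_pos_of_xS_pos {x : Sym2 V → ℝ} {W : Finset (Sym2 V)} (h : 0 < xS x W) :
    ∃ e ∈ W, 0 < x e := by
  by_contra! hc
  exact absurd (Finset.sum_nonpos hc) (not_le.2 h)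

theorem sum_mem_edge {e : Sym2 V} (he : ¬ e.IsDiag) (F : V → ℝ) {a b : V} (hab : e = s(a, b)) :
    ∑ v with v ∈ e, F v = F a + F b := by
  subst hab
  rw [← Finset.sum_pair (f := F) (by simpa using he)]
  congr 1
  ext v
  simp

theorem sum_inc_comm (F : V → Sym2 V → ℝ) :
    ∑ v, ∑ e ∈ inc S.E v, F v e = ∑ e ∈ S.E, ∑ v with v ∈ e, F v e := by
  refine Finset.sum_comm' fun v e => ?_
  simp [mem_inc, and_comm]

theorem sum_xS_inc (x : Sym2 V → ℝ) : ∑ v, xS x (inc S.E v) = 2 * xS x S.E := by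
  simp only [xS]
  rw [sum_inc_comm, Finset.mul_sum]
  refine Finset.sum_congr rfl fun e he => ?_
  induction e with
  | _ a b => rw [sum_mem_edge (S.not_diag _ he) _ rfl]; ring

/-- The weight, as seen by `v`, of the edges that `v` prefers to `e`, those tied with `e` being
counted with weight one half. -/
noncomputable def halfWeight (S : RSetup V) (x : Sym2 V → ℝ) (v : V) (e : Sym2 V) : ℝ :=
  xS x (S.simSet v e) / 2 + xS x (S.succSet v e)

open Classical in
theorem halfWeight_eq_sum (x : Sym2 V → ℝ) (v : V) (e : Sym2 V) :
    S.halfWeight x v e = ∑ f ∈ inc S.E v, x f *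
      ((if S.IPref v (some f) (some e) then 1 / 2 else 0) +
        (if S.SPref v (some f) (some e) then 1 else 0)) := by
  simp only [halfWeight, xS, simSet, succSet, Finset.sum_filter, Finset.sum_div,
    ← Finset.sum_add_distrib]
  refine Finset.sum_congr rfl fun f _ => ?_
  split_ifs <;> ring

theorem sum_halfWeight_add_sum_halfWeight (x y : Sym2 V → ℝ) (v : V) :
    ∑ e ∈ inc S.E v, y e * S.halfWeight x v e + ∑ e ∈ inc S.E v, x e * S.halfWeight y v e =
      xS x (inc S.E v) * xS y (inc S.E v) := by
  simp only [halfWeight_eq_sum, Finset.mul_sum]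
  rw [Finset.sum_comm, ← Finset.sum_add_distrib, xS, xS, Finset.sum_mul_sum]
  refine Finset.sum_congr rfl fun e he => ?_
  rw [← Finset.sum_add_distrib]
  refine Finset.sum_congr rfl fun f hf => ?_
  have := pref_total_some he hf
  by_cases h₁ : S.pref v (some e) (some f) <;> by_cases h₂ : S.pref v (some f) (some e) <;>
    simp_all [IPref, SPref] <;> ring

theorem C2.one_le_sum_halfWeight {x : Sym2 V → ℝ} (hx : S.C2 x) {e : Sym2 V} (he : e ∈ S.E) :
    1 ≤ ∑ v with v ∈ e, S.halfWeight x v e := by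
  induction e with
  | _ a b =>
    rw [sum_mem_edge (S.not_diag _ he) _ rfl]
    have h₁ := hx a b he
    have h₂ := hx b a (Sym2.eq_swap ▸ he)
    rw [Sym2.eq_swap (a := b)] at h₂
    simp only [halfWeight]
    linarith

/-- Self-duality of the linear system: the slacks of the stability constraints, each vector
weighted by the other, sum to an expression that is nonpositive under the degree constraints. -/
theorem sum_slack (x y : Sym2 V → ℝ) :
    ∑ e ∈ S.E, y e * (∑ v with v ∈ e, S.halfWeight x v e - 1) +
      ∑ e ∈ S.E, x e * (∑ v with v ∈ e, S.halfWeight y v e - 1) =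
    ∑ v, (xS x (inc S.E v) * xS y (inc S.E v) - xS x (inc S.E v) / 2 - xS y (inc S.E v) / 2) := by
  have key (x y : Sym2 V → ℝ) :
      ∑ e ∈ S.E, y e * (∑ v with v ∈ e, S.halfWeight x v e - 1) =
        ∑ v, ∑ e ∈ inc S.E v, y e * S.halfWeight x v e - xS y S.E := by
    rw [sum_inc_comm, xS, ← Finset.sum_sub_distrib]
    refine Finset.sum_congr rfl fun e _ => ?_
    rw [mul_sub, Finset.mul_sum, mul_one]
  rw [key, key, Finset.sum_sub_distrib, Finset.sum_sub_distrib, ← Finset.sum_div,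
    ← Finset.sum_div, sum_xS_inc, sum_xS_inc]
  simp only [← sum_halfWeight_add_sum_halfWeight, Finset.sum_add_distrib]
  ring

section Slackness

variable {x y : Sym2 V → ℝ} (hx : ∀ e, 0 ≤ x e) (hy : ∀ e, 0 ≤ y e)
  (hx₁ : S.C1 x) (hy₁ : S.C1 y) (hx₂ : S.C2 x) (hy₂ : S.C2 y)
include hx hy hx₁ hy₁ hx₂ hy₂

theorem complementary_slackness :
    (∀ e ∈ S.E, x e * (∑ v with v ∈ e, S.halfWeight y v e - 1) = 0) ∧
      ∀ v, xS x (inc S.E v) * xS y (inc S.E v) - xS x (inc S.E v) / 2 - xS y (inc S.E v) / 2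
        = 0 := by
  have h := S.sum_slack x y
  have hA : ∀ e ∈ S.E, 0 ≤ y e * (∑ v with v ∈ e, S.halfWeight x v e - 1) := fun e he =>
    mul_nonneg (hy e) (sub_nonneg.2 (hx₂.one_le_sum_halfWeight he))
  have hB : ∀ e ∈ S.E, 0 ≤ x e * (∑ v with v ∈ e, S.halfWeight y v e - 1) := fun e he =>
    mul_nonneg (hx e) (sub_nonneg.2 (hy₂.one_le_sum_halfWeight he))
  have hC : ∀ v ∈ Finset.univ, xS x (inc S.E v) * xS y (inc S.E v) - xS x (inc S.E v) / 2
      - xS y (inc S.E v) / 2 ≤ 0 := fun v _ => by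
    nlinarith [xS_nonneg hx (inc S.E v), xS_nonneg hy (inc S.E v), hx₁ v, hy₁ v]
  have hA' := Finset.sum_nonneg hA
  have hB' := Finset.sum_nonneg hB
  have hC' := Finset.sum_nonpos hC
  exact ⟨(Finset.sum_eq_zero_iff_of_nonneg hB).1 (by linarith),
    fun v => (Finset.sum_eq_zero_iff_of_nonpos hC).1 (by linarith) v (Finset.mem_univ v)⟩

theorem C2_tight {v w : V} (he : s(v, w) ∈ S.E) (hpos : 0 < x s(v, w)) :
    xS y (S.simSet v s(v, w)) + xS y (S.succSet v s(v, w)) + xS y (S.succSet w s(v, w)) = 1 ∧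
      xS y (S.simSet w s(v, w)) = xS y (S.simSet v s(v, w)) := by
  have h := (complementary_slackness hx hy hx₁ hy₁ hx₂ hy₂).1 _ he
  rw [sum_mem_edge (S.not_diag _ he) _ rfl] at h
  have h := (mul_eq_zero.1 h).resolve_left hpos.ne'
  have h₁ := hy₂ v w he
  have h₂ := hy₂ w v (Sym2.eq_swap ▸ he)
  rw [Sym2.eq_swap (a := w)] at h₂
  simp only [halfWeight] at h
  constructor <;> linarith

end Slackness

omit [Fintype V] in
theorem chi_nonneg (σ : Finset (Sym2 V)) (e : Sym2 V) : 0 ≤ chi σ e := by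
  unfold chi; split_ifs <;> norm_num

omit [Fintype V] in
theorem chi_pos {σ : Finset (Sym2 V)} {e : Sym2 V} : 0 < chi σ e ↔ e ∈ σ := by
  unfold chi; split_ifs <;> simp_all

omit [Fintype V] in
theorem one_le_xS_chi {σ W : Finset (Sym2 V)} {e : Sym2 V} (he : e ∈ σ) (hW : e ∈ W) :
    1 ≤ xS (chi σ) W := by
  have h : chi σ e = 1 := by simp [chi, he]
  exact h ▸ le_xS (chi_nonneg σ) hW

theorem IsMatching.C1_chi {σ : Finset (Sym2 V)} (hσ : S.IsMatching σ) : S.C1 (chi σ) := by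
  intro v
  have h : xS (chi σ) (inc S.E v) = ((inc S.E v).filter (· ∈ σ)).card := by
    simp [xS, chi, Finset.filter_mem_eq_inter]
  rw [h]
  refine mod_cast le_trans (Finset.card_le_card fun e he => ?_) (hσ.2 v)
  simp only [Finset.mem_filter, mem_inc] at he ⊢
  exact ⟨he.2, he.1.2⟩

theorem StronglyStable.C2_chi {σ : Finset (Sym2 V)} (hσ : S.StronglyStable σ) :
    S.C2 (chi σ) := by
  intro v w he
  have hn := fun W => xS_nonneg (chi_nonneg σ) W
  have hve : s(v, w) ∈ inc S.E v := mem_inc.2 ⟨he, Sym2.mem_mk_left v w⟩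
  suffices h : 1 ≤ xS (chi σ) (S.simSet v s(v, w)) ∨
      ∃ u ∈ s(v, w), 1 ≤ xS (chi σ) (S.succSet u s(v, w)) by
    have h₁ := hn (S.simSet v s(v, w))
    have h₂ := hn (S.succSet v s(v, w))
    have h₃ := hn (S.succSet w s(v, w))
    rcases h with h | ⟨u, hu, h⟩
    · linarith
    · rcases Sym2.mem_iff.1 hu with rfl | rfl <;> linarith
  by_cases hmem : s(v, w) ∈ σ
  · left
    exact one_le_xS_chi hmem (mem_simSet.2 ⟨hve, pref_refl_some hve, pref_refl_some hve⟩)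
  by_cases hall : ∀ u ∈ s(v, w), S.pref u (some s(v, w)) (matchOf σ u)
  · left
    have hnb := hσ.2 s(v, w)
    have hv : ¬ S.SPref v (some s(v, w)) (matchOf σ v) := fun h =>
      hnb ⟨he, hmem, hall, v, Sym2.mem_mk_left v w, h⟩
    have hp := hall v (Sym2.mem_mk_left v w)
    have hp' : S.pref v (matchOf σ v) (some s(v, w)) := by
      by_contra h
      exact hv ⟨hp, h⟩
    cases hm : matchOf σ v with
    | none =>
      rw [hm] at hp'
      exact absurd hp' (S.pref_none v _ he (Sym2.mem_mk_left v w)).2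
    | some f =>
      rw [hm] at hp hp'
      have hf := mem_inc.1 (mem_of_matchOf_eq_some hm)
      exact one_le_xS_chi hf.1 (mem_simSet.2 ⟨mem_inc.2 ⟨hσ.1.1 hf.1, hf.2⟩, hp', hp⟩)
  · right
    push Not at hall
    obtain ⟨u, hu, hnp⟩ := hall
    refine ⟨u, hu, ?_⟩
    cases hm : matchOf σ u with
    | none =>
      rw [hm] at hnp
      exact absurd (S.pref_none u _ he hu).1 hnp
    | some f =>
      rw [hm] at hnp
      have hf := mem_inc.1 (mem_of_matchOf_eq_some hm)
      have hfE : f ∈ inc S.E u := mem_inc.2 ⟨hσ.1.1 hf.1, hf.2⟩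
      have hp := (pref_total_some (mem_inc.2 ⟨he, hu⟩) hfE).resolve_left hnp
      exact one_le_xS_chi hf.1 (mem_succSet.2 ⟨hfE, hp, hnp⟩)

theorem mem_inc_supp {x : Sym2 V → ℝ} {v : V} {e : Sym2 V} :
    e ∈ inc (S.supp x) v ↔ e ∈ inc S.E v ∧ 0 < x e := by
  simp only [mem_inc, supp, Finset.mem_filter]
  tauto

theorem Bset_nonempty {x : Sym2 V → ℝ} {v : V} (h : (inc (S.supp x) v).Nonempty) :
    (S.Bset x v).Nonempty := by
  classical
  suffices H : ∀ F : Finset (Sym2 V), F ⊆ inc S.E v → F.Nonempty →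
      ∃ e ∈ F, ∀ f ∈ F, S.pref v (some e) (some f) by
    obtain ⟨e, he, hbest⟩ := H _ (fun f hf => (mem_inc_supp.1 hf).1) h
    exact ⟨e, Finset.mem_filter.2 ⟨he, hbest⟩⟩
  intro F hF hne
  induction hne using Finset.Nonempty.cons_induction with
  | singleton a => exact ⟨a, by simp, by simpa using pref_refl_some (hF (by simp))⟩
  | cons a F _ _ ih =>
    obtain ⟨e, he, hbest⟩ := ih fun f hf => hF (Finset.mem_cons_of_mem hf)
    have hFa : a ∈ inc S.E v := hF (by simp)
    have hFe := hF (Finset.mem_cons_of_mem he)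
    rcases pref_total_some hFa hFe with hae | hea
    · refine ⟨a, by simp, fun f hf => ?_⟩
      rcases Finset.mem_cons.1 hf with rfl | hf'
      · exact pref_refl_some hFa
      · exact pref_trans_some hFa hFe (hF hf) hae (hbest f hf')
    · refine ⟨e, Finset.mem_cons_of_mem he, fun f hf => ?_⟩
      rcases Finset.mem_cons.1 hf with rfl | hf'
      · exact hea
      · exact hbest f hf'

section Vertex

variable {x : Sym2 V → ℝ} {v : V}

theorem xS_inc_eq_one (hx : S.memP x) (h : 0 < xS x (inc S.E v)) : xS x (inc S.E v) = 1 := by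
  have := (complementary_slackness hx.1.1 hx.1.1 hx.2.1 hx.2.1 hx.2.2.1 hx.2.2.1).2 v
  nlinarith

theorem xS_sim_add_xS_succ_of_mem_Wset (hx : S.memP x) {e : Sym2 V} (he : e ∈ S.Wset x v) :
    xS x (S.simSet v e) + xS x (S.succSet v e) = 1 := by
  classical
  obtain ⟨hes, hworst⟩ := Finset.mem_filter.1 he
  obtain ⟨heE, hpos⟩ := mem_inc_supp.1 hes
  rw [← xS_inc_eq_one hx (hpos.trans_le (le_xS hx.1.1 heE))]
  simp only [xS, simSet, succSet, Finset.sum_filter, ← Finset.sum_add_distrib]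
  refine Finset.sum_congr rfl fun f hf => ?_
  rcases (hx.1.1 f).eq_or_lt with h | h
  · simp [← h]
  · have := hworst f (mem_inc_supp.2 ⟨hf, h⟩)
    by_cases h' : S.pref v (some e) (some f) <;> simp [IPref, SPref, this, h']

end Vertex

end RSetup

open RSetup in
/-- Lemma 12: for `x ∈ P`, a strongly stable matching `σ`,
`v ∈ P'`, and an edge `e = {v, w} ∈ W_x(v)`, we have `w ∈ Q'`. -/
theorem mem_Qset_of_adj_Pset
    {V : Type*} [Fintype V] [DecidableEq V] (S : RSetup V)
    (hP : ∃ y : Sym2 V → ℝ, S.memP y)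
    (x : Sym2 V → ℝ) (hx : S.memP x)
    (σ : Finset (Sym2 V)) (hσ : S.StronglyStable σ)
    (v w : V) (hv : v ∈ S.Pset x σ)
    (he : s(v, w) ∈ S.Wset x v) :
    w ∈ S.Qset x σ := by
  classical
  have hes := (Finset.mem_filter.1 he).1
  obtain ⟨hev, hpos⟩ := mem_inc_supp.1 hes
  have heE := (mem_inc.1 hev).1
  have hew : s(v, w) ∈ inc S.E w := mem_inc.2 ⟨heE, Sym2.mem_mk_right v w⟩
  have hsum := xS_sim_add_xS_succ_of_mem_Wset hx he
  obtain ⟨htx, hsx⟩ :=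
    C2_tight hx.1.1 hx.1.1 hx.2.1 hx.2.1 hx.2.2.1 hx.2.2.1 heE hpos
  obtain ⟨htσ, hsσ⟩ :=
    C2_tight hx.1.1 (chi_nonneg σ) hx.2.1 hσ.1.C1_chi hx.2.2.1 hσ.C2_chi heE hpos
  have hdeg : 0 < xS x (inc S.E w) := hpos.trans_le (le_xS hx.1.1 hew)
  have hbest : ∀ f ∈ inc (S.supp x) w, S.pref w (some s(v, w)) (some f) := by
    intro f hf
    obtain ⟨hfE, hfpos⟩ := mem_inc_supp.1 hf
    by_contra hnp
    have hfp := (pref_total_some hew hfE).resolve_left hnp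
    have := le_xS hx.1.1 (mem_succSet.2 ⟨hfE, hfp, hnp⟩)
    linarith
  have hBw : ∀ f ∈ S.Bset x w, f ∈ inc S.E w ∧ S.IPref w (some f) (some s(v, w)) := by
    intro f hf
    obtain ⟨hfs, hfb⟩ := Finset.mem_filter.1 hf
    exact ⟨(mem_inc_supp.1 hfs).1, hfb _ (mem_inc_supp.2 ⟨hew, hpos⟩), hbest f hfs⟩
  refine ⟨⟨x, hx, hdeg⟩, ?_⟩
  rcases hv.2 with hstrict | ⟨hBW, hind⟩
  · left
    have hS := hstrict _ he
    have hzero (W : Finset (Sym2 V)) (hW : W ⊆ inc S.E v)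
        (hp : ∀ f ∈ W, S.pref v (some f) (some s(v, w))) : xS (chi σ) W ≤ 0 := by
      by_contra! hlt
      obtain ⟨f, hfW, hf⟩ := exists_pos_of_xS_pos hlt
      rw [hσ.1.matchOf_eq_some
        (mem_inc.2 ⟨chi_pos.1 hf, (mem_inc.1 (hW hfW)).2⟩)] at hS
      exact hS.2 (hp f hfW)
    have h₁ := hzero (S.simSet v s(v, w)) (Finset.filter_subset _ _)
      fun f hf => (mem_simSet.1 hf).2.1
    have h₂ := hzero (S.succSet v s(v, w)) (Finset.filter_subset _ _)
      fun f hf => (mem_succSet.1 hf).2.1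
    obtain ⟨g, hgW, hg⟩ := exists_pos_of_xS_pos
      (show 0 < xS (chi σ) (S.succSet w s(v, w)) by linarith)
    obtain ⟨hgE, hgs⟩ := mem_succSet.1 hgW
    rw [hσ.1.matchOf_eq_some (mem_inc.2 ⟨chi_pos.1 hg, (mem_inc.1 hgE).2⟩)]
    intro f hf
    obtain ⟨hfE, hfi⟩ := hBw f hf
    exact ⟨pref_trans_some hgE hew hfE hgs.1 hfi.2,
      fun h => hgs.2 (pref_trans_some hew hfE hgE hfi.2 h)⟩
  · right
    constructor
    · obtain ⟨b, hb⟩ := Bset_nonempty ⟨_, hes⟩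
      have hbS := hBW b hb _ he
      obtain ⟨hbE, hbpos⟩ := mem_inc_supp.1 (Finset.mem_filter.1 hb).1
      have hsucc := le_xS hx.1.1 (mem_succSet.2 ⟨hbE, hbS⟩)
      have hone := xS_inc_eq_one hx hdeg
      obtain ⟨k, hk, hkpos, hkn⟩ : ∃ k ∈ inc S.E w, 0 < x k ∧
          ¬ S.IPref w (some k) (some s(v, w)) := by
        by_contra! hc
        have hle : xS x (inc S.E w) ≤ xS x (S.simSet w s(v, w)) := by
          simp only [xS, simSet, Finset.sum_filter]
          refine Finset.sum_le_sum fun f hf => ?_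
          split_ifs with hi
          · exact le_rfl
          · exact not_lt.1 fun h => hi (hc f hf h)
        linarith
      have hks := mem_inc_supp.2 ⟨hk, hkpos⟩
      have hkb := hbest k hks
      intro f hf g hg
      obtain ⟨hfE, hfi⟩ := hBw f hf
      obtain ⟨hgs, hgw⟩ := Finset.mem_filter.1 hg
      have hgE := (mem_inc_supp.1 hgs).1
      refine ⟨pref_trans_some hfE hew hgE hfi.1 (hbest g hgs), fun h => hkn ⟨?_, hkb⟩⟩
      exact pref_trans_some hk hgE hew (hgw k hks) (pref_trans_some hgE hfE hew h hfi.1)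
    · have hI := hind _ he
      cases hm : matchOf σ v with
      | none =>
        rw [hm] at hI
        exact absurd hI.2 (S.pref_none v _ heE (Sym2.mem_mk_left v w)).2
      | some m =>
        rw [hm] at hI
        have hmσ := mem_inc.1 (mem_of_matchOf_eq_some hm)
        have h₁ := one_le_xS_chi hmσ.1 (mem_simSet.2
          ⟨mem_inc.2 ⟨hσ.1.1 hmσ.1, hmσ.2⟩, hI.2, hI.1⟩)
        obtain ⟨g, hgW, hg⟩ := exists_pos_of_xS_pos
          (show 0 < xS (chi σ) (S.simSet w s(v, w)) by linarith)
        obtain ⟨hgE, hgs⟩ := mem_simSet.1 hgW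
        rw [hσ.1.matchOf_eq_some (mem_inc.2 ⟨chi_pos.1 hg, (mem_inc.1 hgE).2⟩)]
        intro f hf
        obtain ⟨hfE, hfi⟩ := hBw f hf
        exact ⟨pref_trans_some hfE hew hgE hfi.1 hgs.2, pref_trans_some hgE hew hfE hgs.1 hfi.2⟩
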